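/- Let k > 0, T > 0, and β ∈ L^∞(0,T). Let U : ℝ × [0,T] → ℝ be bounded and continuous, twice continuously differentiable in x and once in t on ℝ × (0,T], satisfying U_t = k U_{xx} + β(t)|U| on ℝ × (0,T] and U(·,0) = F_I, where F_I : ℝ → ℝ is bounded and measurable, F_I ≥ 0 a.e. on (−∞,0), F_I ≤ 0 a.e. on (0,∞), and there exist c > 0 and R > 0 such that ∫_x^{x+1} F_I(ξ) dξ ≥ c for all x ≤ −R and ∫_x^{x+1} F_I(ξ) dξ ≤ −c for all x ≥ R. Then for every t ∈ (0,T] the zero set {x ∈ ℝ : U(x,t) = 0} is nonempty, and there exists M = M(T) > 0 such that every zero of U(·,t), for every t ∈ (0,T], lies in the interval [−M,M]. In other words, the free boundary (the zero level set of U) exists and stays locally bounded in time; it cannot become unbounded in finite time. -/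

import Mathlib

open MeasureTheory Set

lemma aux_second_deriv (f f' : ℝ → ℝ) (f'' x : ℝ) (hf : ∀ y, HasDerivAt f (f' y) y)
    (hf' : HasDerivAt f' f'' x) (hmin : IsLocalMin f x) : 0 ≤ f'' := by
  by_contra hneg
  push Not at hneg
  have hd : deriv f = f' := funext fun y => (hf y).deriv
  have h0 : f' x = 0 := hmin.hasDerivAt_eq_zero (hf x)
  have hmax : IsLocalMax f x := by
    apply isLocalMax_of_deriv_deriv_neg
    · rw [hd, hf'.deriv]; exact hneg
    · rw [hd, h0]
    · exact (hf x).continuousAt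
  have hconst : ∀ᶠ y in nhds x, f y = f x := by
    filter_upwards [hmin, hmax] with y h1 h2
    exact le_antisymm h2 h1
  have hz : ∀ᶠ y in nhds x, f' y = 0 := by
    filter_upwards [hconst.eventually_nhds] with y hy
    have h1 : HasDerivAt f 0 y := (hasDerivAt_const y (f x)).congr_of_eventuallyEq hy
    exact (hf y).unique h1
  have h2 : HasDerivAt f' 0 x := (hasDerivAt_const x (0:ℝ)).congr_of_eventuallyEq hz
  have := hf'.unique h2
  linarith

lemma aux_time_deriv (f : ℝ → ℝ) (f' t : ℝ) (ht : 0 < t) (hf : HasDerivAt f f' t)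
    (hmin : ∀ s ∈ Ioc 0 t, f t ≤ f s) : f' ≤ 0 := by
  have h := hf.hasDerivWithinAt (s := Iio t)
  rw [hasDerivWithinAt_iff_tendsto_slope' (by simp)] at h
  refine le_of_tendsto h ?_
  have : Ioo 0 t ∈ nhdsWithin t (Iio t) := Ioo_mem_nhdsLT ht
  filter_upwards [this] with s hs
  rw [slope_def_field]
  apply div_nonpos_of_nonneg_of_nonpos
  · linarith [hmin s ⟨hs.1, hs.2.le⟩]
  · linarith [hs.2]

lemma aux_maxp (k B t0 C : ℝ) (hk : 0 < k) (z zx zxx zt : ℝ → ℝ → ℝ)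
    (hcont : Continuous fun p : ℝ × ℝ => z p.1 p.2)
    (hbd : ∀ x, ∀ t ∈ Icc 0 t0, -C ≤ z x t) (hB : 0 ≤ B)
    (h0 : ∀ x, 0 ≤ z x 0)
    (hx : ∀ x, ∀ t ∈ Ioc 0 t0, HasDerivAt (fun y => z y t) (zx x t) x)
    (hxx : ∀ x, ∀ t ∈ Ioc 0 t0, HasDerivAt (fun y => zx y t) (zxx x t) x)
    (ht : ∀ x, ∀ t ∈ Ioc 0 t0, HasDerivAt (fun s => z x s) (zt x t) t)
    (hineq : ∀ x, ∀ t ∈ Ioc 0 t0, z x t < 0 → k * zxx x t + B * z x t ≤ zt x t)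
    (x t : ℝ) (htm : t ∈ Icc 0 t0) : 0 ≤ z x t := by
  have key : ∀ ε > 0, 0 ≤ Real.exp (-B * t) * z x t + ε * (1 + x ^ 2 + 3 * k * t) := by
    intro ε hε
    by_contra hneg
    push Not at hneg
    set Z : ℝ × ℝ → ℝ := fun p => Real.exp (-B * p.2) * z p.1 p.2
      + ε * (1 + p.1 ^ 2 + 3 * k * p.2) with hZ
    have hZc : Continuous Z := by
      have h1 : Continuous fun p : ℝ × ℝ => Real.exp (-B * p.2) := by fun_prop
      exact (h1.mul hcont).add (by fun_prop)
    set L : ℝ := 1 + |x| + |C| / ε with hL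
    have hLpos : 1 ≤ L := by have := abs_nonneg x; have : 0 ≤ |C| / ε := by positivity
                             linarith
    have hxL : x ∈ Icc (-L) L := by
      have : 0 ≤ |C| / ε := by positivity
      constructor
      · linarith [neg_abs_le x]
      · linarith [le_abs_self x]
    obtain ⟨⟨x1, t1⟩, hmem, hmin⟩ := (isCompact_Icc.prod isCompact_Icc :
      IsCompact (Icc (-L) L ×ˢ Icc 0 t0)).exists_isMinOn ⟨(x, t), hxL, htm⟩ hZc.continuousOn
    obtain ⟨hx1, ht1⟩ := hmem
    simp only at hx1 ht1
    have hmin' : ∀ y ∈ Icc (-L) L, ∀ s ∈ Icc 0 t0, Z (x1, t1) ≤ Z (y, s) :=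
      fun y hy s hs => hmin (show (y, s) ∈ _ from ⟨hy, hs⟩)
    have hZneg : Z (x1, t1) < 0 := lt_of_le_of_lt (hmin' x hxL t htm) hneg
    have hepos : 0 < Real.exp (-B * t1) := Real.exp_pos _
    have hpen : 0 < ε * (1 + x1 ^ 2 + 3 * k * t1) := by
      have := ht1.1; positivity
    have hzneg : z x1 t1 < 0 := by
      by_contra h
      push Not at h
      have : 0 ≤ Real.exp (-B * t1) * z x1 t1 := by positivity
      simp only [hZ] at hZneg
      linarith
    have ht1pos : 0 < t1 := by
      rcases ht1.1.eq_or_lt with h | h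
      · rw [← h] at hzneg; linarith [h0 x1]
      · exact h
    have ht1' : t1 ∈ Ioc 0 t0 := ⟨ht1pos, ht1.2⟩
    have hzlow : -|C| ≤ Real.exp (-B * t1) * z x1 t1 := by
      have h1 : Real.exp (-B * t1) ≤ 1 := by
        rw [Real.exp_le_one_iff]; nlinarith
      have h2 := hbd x1 t1 ht1
      have h3 := le_abs_self C
      nlinarith
    have hx1L : |x1| < L := by
      by_contra h
      push Not at h
      have h2 : L ≤ x1 ^ 2 := by
        have : L ^ 2 ≤ x1 ^ 2 := by
          rw [← sq_abs x1]; gcongr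
        nlinarith
      have h3 : ε * L ≤ ε * (1 + x1 ^ 2 + 3 * k * t1) := by
        apply mul_le_mul_of_nonneg_left _ hε.le
        have : 0 ≤ 3 * k * t1 := by positivity
        linarith
      have h4 : |C| ≤ ε * L := by
        have : ε * (|C| / ε) = |C| := by field_simp
        have h5 : ε * L = ε * (1 + |x|) + ε * (|C| / ε) := by rw [hL]; ring
        have : 0 ≤ ε * (1 + |x|) := by positivity
        linarith
      simp only [hZ] at hZneg
      linarith
    have hlocmin : IsLocalMin (fun y => Z (y, t1)) x1 := by
      have : Icc (-L) L ∈ nhds x1 := Icc_mem_nhds (abs_lt.1 hx1L).1 (abs_lt.1 hx1L).2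
      filter_upwards [this] with y hy
      exact hmin' y hy t1 ht1
    have hd1 : ∀ y, HasDerivAt (fun y => Z (y, t1))
        (Real.exp (-B * t1) * zx y t1 + ε * (2 * y)) y := by
      intro y
      have := ((hx y t1 ht1').const_mul (Real.exp (-B * t1))).add
        ((((hasDerivAt_pow 2 y).const_add 1).add_const (3 * k * t1)).const_mul ε)
      refine HasDerivAt.congr_deriv this ?_
      norm_num
    have hd2 : HasDerivAt (fun y => Real.exp (-B * t1) * zx y t1 + ε * (2 * y))
        (Real.exp (-B * t1) * zxx x1 t1 + ε * 2) x1 := by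
      have := ((hxx x1 t1 ht1').const_mul (Real.exp (-B * t1))).add
        (((hasDerivAt_id x1).const_mul 2).const_mul ε)
      refine HasDerivAt.congr_deriv this ?_
      norm_num
    have hs := aux_second_deriv _ _ _ _ hd1 hd2 hlocmin
    have hdt : HasDerivAt (fun s => Z (x1, s))
        (Real.exp (-B * t1) * (-B) * z x1 t1 + Real.exp (-B * t1) * zt x1 t1 + ε * (3 * k)) t1 := by
      have he : HasDerivAt (fun s : ℝ => Real.exp (-B * s)) (Real.exp (-B * t1) * (-B)) t1 := by
        have := ((hasDerivAt_id t1).const_mul (-B)).exp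
        simpa using this
      have := (he.mul (ht x1 t1 ht1')).add
        ((((hasDerivAt_id t1).const_mul (3 * k)).const_add (1 + x1 ^ 2)).const_mul ε)
      refine HasDerivAt.congr_deriv this ?_
      norm_num
    have hq := aux_time_deriv _ _ _ ht1pos hdt
      (fun s hs => hmin' x1 hx1 s ⟨hs.1.le, hs.2.trans ht1.2⟩)
    have hi := hineq x1 t1 ht1' hzneg
    have hi2 := mul_le_mul_of_nonneg_left hi hepos.le
    nlinarith [mul_le_mul_of_nonneg_left hs hk.le, mul_pos hε hk]
  have hlim : 0 ≤ Real.exp (-B * t) * z x t := by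
    by_contra h
    push Not at h
    set a := Real.exp (-B * t) * z x t
    have hA : 0 < 1 + x ^ 2 + 3 * k * t := by have := htm.1; positivity
    have := key (-a / (2 * (1 + x ^ 2 + 3 * k * t))) (by apply div_pos <;> linarith)
    have e : -a / (2 * (1 + x ^ 2 + 3 * k * t)) * (1 + x ^ 2 + 3 * k * t) = -a / 2 := by
      field_simp
    rw [e] at this
    linarith
  exact nonneg_of_mul_nonneg_right hlim (Real.exp_pos _)

lemma aux_param (a b : ℝ) (K K' : ℝ → ℝ → ℝ) (s0 : ℝ) (S : Set ℝ) (hS : S ∈ nhds s0)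
    (hSc : IsCompact S)
    (hK : ∀ s ∈ S, Continuous (K s))
    (hd : ∀ s ∈ S, ∀ y, HasDerivAt (fun s => K s y) (K' s y) s)
    (hK' : ContinuousOn (fun p : ℝ × ℝ => K' p.1 p.2) (S ×ˢ univ)) :
    HasDerivAt (fun s => ∫ y in a..b, K s y) (∫ y in a..b, K' s0 y) s0 := by
  have hs0 : s0 ∈ S := mem_of_mem_nhds hS
  have hcomp : IsCompact (S ×ˢ uIcc a b) := hSc.prod isCompact_uIcc
  obtain ⟨D, hD⟩ := hcomp.exists_bound_of_continuousOn
    (hK'.mono (prod_mono_right (subset_univ _)))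
  have hK's0 : Continuous (K' s0) := by
    rw [← continuousOn_univ]
    exact hK'.comp (f := fun y => (s0, y)) (by fun_prop) (fun y _ => ⟨hs0, mem_univ _⟩)
  refine (intervalIntegral.hasDerivAt_integral_of_dominated_loc_of_deriv_le (bound := fun _ => D)
    hS ?_ ((hK s0 hs0).intervalIntegrable _ _) hK's0.aestronglyMeasurable ?_ (by simp) ?_).2
  · filter_upwards [hS] with s hs
    exact (hK s hs).aestronglyMeasurable
  · refine Filter.Eventually.of_forall fun y hy s hs => hD (s, y) ⟨hs, uIoc_subset_uIcc hy⟩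
  · exact Filter.Eventually.of_forall fun y _ s hs => hd s hs y

noncomputable def auxg (k x t : ℝ) : ℝ := (√(4 * k * t))⁻¹ * Real.exp (-(x ^ 2) / (4 * k * t))

lemma auxg_x (k x t : ℝ) (hk : 0 < k) (ht : 0 < t) :
    HasDerivAt (fun x => auxg k x t) (-(x / (2 * k * t)) * auxg k x t) x := by
  unfold auxg
  have := ((((hasDerivAt_pow 2 x).neg).div_const (4 * k * t)).exp).const_mul (√(4 * k * t))⁻¹
  refine HasDerivAt.congr_deriv this ?_
  norm_num
  field_simp
  ring

lemma auxg_xx (k x t : ℝ) (hk : 0 < k) (ht : 0 < t) :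
    HasDerivAt (fun x => -(x / (2 * k * t)) * auxg k x t)
      ((x ^ 2 / (4 * k ^ 2 * t ^ 2) - 1 / (2 * k * t)) * auxg k x t) x := by
  have := (((hasDerivAt_id x).div_const (2 * k * t)).neg).mul (auxg_x k x t hk ht)
  refine HasDerivAt.congr_deriv this ?_
  simp only [id, Pi.neg_apply]
  field_simp
  ring

lemma auxg_t (k x t : ℝ) (hk : 0 < k) (ht : 0 < t) :
    HasDerivAt (fun t => auxg k x t)
      (k * ((x ^ 2 / (4 * k ^ 2 * t ^ 2) - 1 / (2 * k * t)) * auxg k x t)) t := by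
  unfold auxg
  have hpos : 0 < 4 * k * t := by positivity
  have hl : HasDerivAt (fun t => 4 * k * t) (4 * k) t := by
    simpa using (hasDerivAt_id t).const_mul (4 * k)
  have h1 := (hl.sqrt hpos.ne').inv (Real.sqrt_pos.2 hpos).ne'
  have h2 := ((hl.inv hpos.ne').const_mul (-(x ^ 2))).exp
  have := h1.mul h2
  have hsq : √(4 * k * t) ^ 2 = 4 * k * t := Real.sq_sqrt hpos.le
  have e : ∀ s, -(x ^ 2) / (4 * k * s) = -(x ^ 2) * (fun t => 4 * k * t)⁻¹ s := by
    intro s; simp only [Pi.inv_apply, div_eq_mul_inv]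
  simp only [e]
  refine this.congr_deriv ?_
  simp only [Pi.inv_apply]
  set r := √(4 * k * t) with hr
  have hr0 : r ≠ 0 := (Real.sqrt_pos.2 hpos).ne'
  rw [hsq]
  field_simp
  ring

lemma auxg_cont (k : ℝ) (hk : 0 < k) :
    ContinuousOn (fun p : ℝ × ℝ => auxg k p.1 p.2) (univ ×ˢ Ioi 0) := by
  unfold auxg
  have h4 : ∀ p ∈ (univ ×ˢ Ioi 0 : Set (ℝ × ℝ)), 4 * k * p.2 ≠ 0 := by
    rintro ⟨x, t⟩ ⟨-, h⟩
    have : (0:ℝ) < t := h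
    simp only
    positivity
  apply ContinuousOn.mul
  · apply ContinuousOn.inv₀ (by fun_prop)
    rintro ⟨x, t⟩ ⟨-, h⟩
    have : (0:ℝ) < t := h
    exact (Real.sqrt_pos.2 (by positivity)).ne'
  · apply Real.continuous_exp.comp_continuousOn
    exact ContinuousOn.div (by fun_prop) (by fun_prop) h4

lemma auxgxx_cont (k : ℝ) (hk : 0 < k) :
    ContinuousOn (fun p : ℝ × ℝ => (p.1 ^ 2 / (4 * k ^ 2 * p.2 ^ 2) - 1 / (2 * k * p.2))
      * auxg k p.1 p.2) (univ ×ˢ Ioi 0) := by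
  apply ContinuousOn.mul _ (auxg_cont k hk)
  have h4 : ∀ p ∈ (univ ×ˢ Ioi 0 : Set (ℝ × ℝ)), p.2 ≠ 0 := by
    rintro ⟨x, t⟩ ⟨-, h⟩
    exact (show (0:ℝ) < t from h).ne'
  apply ContinuousOn.sub
  · exact ContinuousOn.div (by fun_prop) (by fun_prop) (fun p hp => by have := h4 p hp; positivity)
  · exact ContinuousOn.div (by fun_prop) (by fun_prop) (fun p hp => by have := h4 p hp; positivity)

lemma aux_heat (k a b C : ℝ) (hk : 0 < k) (hab : a ≤ b) (f : ℝ → ℝ) (hf : Continuous f)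
    (hf0 : ∀ x, 0 ≤ f x) (hfC : ∀ x, f x ≤ C) (hsupp : ∀ x, x ∉ Ioc a b → f x = 0) :
    ∃ p px pxx pt : ℝ → ℝ → ℝ, (Continuous fun q : ℝ × ℝ => p q.1 q.2) ∧
      (∀ x, p x 0 = √Real.pi * f x) ∧ (∀ x t, 0 ≤ p x t) ∧ (∀ x t, p x t ≤ √Real.pi * C) ∧
      (∀ x t, 0 < t → HasDerivAt (fun y => p y t) (px x t) x) ∧
      (∀ x t, 0 < t → HasDerivAt (fun y => px y t) (pxx x t) x) ∧
      (∀ x t, 0 < t → HasDerivAt (fun s => p x s) (pt x t) t) ∧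
      (∀ x t, 0 < t → pt x t = k * pxx x t) ∧
      (∀ x t, 0 < t → p x t = ∫ y in a..b, f y * auxg k (x - y) t) := by
  have hC : 0 ≤ C := (hf0 0).trans (hfC 0)
  have hgi : Integrable (fun z : ℝ => Real.exp (-1 * z ^ 2)) := integrable_exp_neg_mul_sq one_pos
  have hgv : ∫ z : ℝ, Real.exp (-1 * z ^ 2) = √Real.pi := by
    rw [integral_gaussian]; simp
  set p : ℝ → ℝ → ℝ := fun x t => ∫ z, f (x + √(4 * k * t) * z) * Real.exp (-1 * z ^ 2) with hp
  have hle : ∀ x t z, f (x + √(4 * k * t) * z) * Real.exp (-1 * z ^ 2)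
      ≤ C * Real.exp (-1 * z ^ 2) := fun x t z =>
    mul_le_mul_of_nonneg_right (hfC _) (Real.exp_pos _).le
  have hnn : ∀ x t z, 0 ≤ f (x + √(4 * k * t) * z) * Real.exp (-1 * z ^ 2) := fun x t z =>
    mul_nonneg (hf0 _) (Real.exp_pos _).le
  have hrep : ∀ x t, 0 < t → p x t = ∫ y in a..b, f y * auxg k (x - y) t := by
    intro x t ht
    have hpos : 0 < 4 * k * t := by positivity
    set r := √(4 * k * t) with hr
    have hr0 : 0 < r := Real.sqrt_pos.2 hpos
    have hsq : r ^ 2 = 4 * k * t := Real.sq_sqrt hpos.le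
    have e1 : ∫ y in a..b, f y * auxg k (x - y) t = ∫ y, f y * auxg k (x - y) t := by
      rw [intervalIntegral.integral_of_le hab]
      apply setIntegral_eq_integral_of_forall_compl_eq_zero
      intro y hy
      rw [hsupp y hy, zero_mul]
    rw [e1, ← integral_add_left_eq_self _ x]
    have e2 := Measure.integral_comp_mul_left (fun w => f (x + w) * auxg k (x - (x + w)) t) r
    have e3 : ∫ y, f (x + y) * auxg k (x - (x + y)) t
        = r * ∫ z, f (x + r * z) * auxg k (x - (x + r * z)) t := by
      rw [e2, abs_of_pos (inv_pos.2 hr0), smul_eq_mul, mul_inv_cancel_left₀ hr0.ne']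
    rw [e3, ← integral_const_mul]
    simp only [hp]
    congr 1
    ext z
    unfold auxg
    rw [← hr, ← hsq]
    have : -(x - (x + r * z)) ^ 2 / r ^ 2 = -1 * z ^ 2 := by field_simp; ring
    rw [this]
    field_simp
  have hcont_gx : ∀ x t : ℝ, 0 < t → Continuous fun y => f y * auxg k (x - y) t := by
    intro x t ht
    apply hf.mul
    rw [← continuousOn_univ]
    exact (auxg_cont k hk).comp (f := fun y => (x - y, t)) (by fun_prop)
      (fun y _ => ⟨mem_univ _, ht⟩)
  refine ⟨p, fun x t => ∫ y in a..b, f y * (-((x - y) / (2 * k * t)) * auxg k (x - y) t),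
    fun x t => ∫ y in a..b, f y * (((x - y) ^ 2 / (4 * k ^ 2 * t ^ 2) - 1 / (2 * k * t))
      * auxg k (x - y) t),
    fun x t => k * ∫ y in a..b, f y * (((x - y) ^ 2 / (4 * k ^ 2 * t ^ 2) - 1 / (2 * k * t))
      * auxg k (x - y) t), ?_, ?_, ?_, ?_, ?_, ?_, ?_, ?_, hrep⟩
  · refine continuous_of_dominated (bound := fun z => C * Real.exp (-1 * z ^ 2)) ?_ ?_
      (hgi.const_mul C) ?_
    · intro q
      exact Continuous.aestronglyMeasurable (by fun_prop)
    · intro q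
      refine Filter.Eventually.of_forall fun z => ?_
      rw [Real.norm_eq_abs, abs_of_nonneg (hnn _ _ _)]
      exact hle _ _ _
    · refine Filter.Eventually.of_forall fun z => ?_
      fun_prop
  · intro x
    simp only [hp]
    simp only [mul_zero, Real.sqrt_zero, zero_mul, add_zero]
    rw [integral_const_mul, hgv, mul_comm]
  · intro x t
    exact integral_nonneg fun z => hnn x t z
  · intro x t
    have : ∫ z : ℝ, C * Real.exp (-1 * z ^ 2) = √Real.pi * C := by
      rw [integral_const_mul, hgv, mul_comm]
    rw [← this]
    exact integral_mono_of_nonneg (Filter.Eventually.of_forall fun z => hnn x t z)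
      (hgi.const_mul C) (Filter.Eventually.of_forall fun z => hle x t z)
  · intro x t ht
    have e : (fun y => p y t) = fun x => ∫ y in a..b, f y * auxg k (x - y) t :=
      funext fun y => hrep y t ht
    rw [e]
    apply aux_param a b (fun x y => f y * auxg k (x - y) t)
      (fun x y => f y * (-((x - y) / (2 * k * t)) * auxg k (x - y) t)) x (Metric.closedBall x 1)
      (Metric.closedBall_mem_nhds x one_pos) (isCompact_closedBall x 1)
    · intro s _; exact hcont_gx s t ht
    · intro s _ y
      exact ((auxg_x k (s - y) t hk ht).comp_sub_const s y).const_mul (f y)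
    · apply ContinuousOn.mul (by fun_prop)
      apply ContinuousOn.mul (by fun_prop)
      exact (auxg_cont k hk).comp (f := fun q : ℝ × ℝ => (q.1 - q.2, t)) (by fun_prop)
        (fun y _ => ⟨mem_univ _, ht⟩)
  · intro x t ht
    apply aux_param a b (fun x y => f y * (-((x - y) / (2 * k * t)) * auxg k (x - y) t))
      (fun x y => f y * (((x - y) ^ 2 / (4 * k ^ 2 * t ^ 2) - 1 / (2 * k * t))
      * auxg k (x - y) t)) x (Metric.closedBall x 1)
      (Metric.closedBall_mem_nhds x one_pos) (isCompact_closedBall x 1)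
    · intro s _
      apply hf.mul
      apply Continuous.mul (by fun_prop)
      rw [← continuousOn_univ]
      exact (auxg_cont k hk).comp (f := fun y => (s - y, t)) (by fun_prop)
        (fun y _ => ⟨mem_univ _, ht⟩)
    · intro s _ y
      exact ((auxg_xx k (s - y) t hk ht).comp_sub_const s y).const_mul (f y)
    · apply ContinuousOn.mul (by fun_prop)
      exact (auxgxx_cont k hk).comp (f := fun q : ℝ × ℝ => (q.1 - q.2, t)) (by fun_prop)
        (fun y _ => ⟨mem_univ _, ht⟩)
  · intro x t ht
    have e : (fun s => p x s) =ᶠ[nhds t] fun t => ∫ y in a..b, f y * auxg k (x - y) t := by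
      filter_upwards [lt_mem_nhds ht] with s hs
      exact hrep x s hs
    refine HasDerivAt.congr_of_eventuallyEq ?_ e
    have hsub : ∀ s ∈ Icc (t / 2) (2 * t), 0 < s := fun s hs => by linarith [hs.1]
    have := aux_param a b (fun t y => f y * auxg k (x - y) t)
      (fun t y => f y * (k * (((x - y) ^ 2 / (4 * k ^ 2 * t ^ 2) - 1 / (2 * k * t))
      * auxg k (x - y) t))) t (Icc (t / 2) (2 * t))
      (Icc_mem_nhds (by linarith) (by linarith)) isCompact_Icc
      (fun s hs => hcont_gx x s (hsub s hs))
      (fun s hs y => (auxg_t k (x - y) s hk (hsub s hs)).const_mul (f y)) ?_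
    · refine this.congr_deriv ?_
      show _ = k * _
      rw [← intervalIntegral.integral_const_mul]
      congr 1
      ext y
      ring
    · apply ContinuousOn.mul (by fun_prop)
      apply ContinuousOn.mul (by fun_prop)
      exact (auxgxx_cont k hk).comp (f := fun q : ℝ × ℝ => (x - q.2, q.1)) (by fun_prop)
        (fun y hy => ⟨mem_univ _, hsub _ hy.1⟩)
  · intro x t _
    rfl

lemma aux_left (k T : ℝ) (hk : 0 < k) (hT : 0 < T) (β : ℝ → ℝ) (B C : ℝ) (hB : 0 ≤ B) (hC : 0 ≤ C)
    (hβ : ∀ s ∈ Ioc (0 : ℝ) T, |β s| ≤ B)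
    (U Ux Uxx Ut : ℝ → ℝ → ℝ)
    (hUcont : Continuous fun p : ℝ × ℝ => U p.1 p.2)
    (hUbdd : ∀ x : ℝ, ∀ t ∈ Icc (0 : ℝ) T, |U x t| ≤ C)
    (hUx : ∀ x : ℝ, ∀ t ∈ Ioc (0 : ℝ) T, HasDerivAt (fun y => U y t) (Ux x t) x)
    (hUxx : ∀ x : ℝ, ∀ t ∈ Ioc (0 : ℝ) T, HasDerivAt (fun y => Ux y t) (Uxx x t) x)
    (hUt : ∀ x : ℝ, ∀ t ∈ Ioc (0 : ℝ) T, HasDerivAt (fun s => U x s) (Ut x t) t)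
    (hPDE : ∀ x : ℝ, ∀ t ∈ Ioc (0 : ℝ) T, Ut x t = k * Uxx x t + β t * |U x t|)
    (hpos : ∀ x < 0, 0 ≤ U x 0)
    (c R : ℝ) (hc : 0 < c) (hR : 0 < R)
    (hmass : ∀ x : ℝ, x ≤ -R → c ≤ ∫ ξ in x..(x + 1), U ξ 0) :
    ∃ M > 0, ∀ t ∈ Ioc (0 : ℝ) T, ∀ x ≤ -M, 0 < U x t := by
  set κ : ℝ := (√Real.pi)⁻¹ with hκ
  have hpi : 0 < √Real.pi := Real.sqrt_pos.2 Real.pi_pos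
  have hκ0 : 0 < κ := inv_pos.2 hpi
  set A : ℝ := Real.exp (-B * T) * κ * c * (√(4 * k * T))⁻¹ with hA
  have hA0 : 0 < A := by
    have : 0 < √(4 * k * T) := Real.sqrt_pos.2 (by positivity)
    positivity
  set D : ℝ := C * Real.exp (B * T) with hD
  have hD0 : 0 ≤ D := by positivity
  have hDA : 0 ≤ 4 * k * T * (D / A) := by positivity
  refine ⟨10 + R + 4 * k * T * (D / A), by positivity, ?_⟩
  intro t0 ht0 x0 hx0
  have ht0p : 0 < t0 := ht0.1
  have hU0 : Continuous fun y => U y 0 :=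
    hUcont.comp (f := fun y : ℝ => (y, (0:ℝ))) (by fun_prop)
  set a : ℝ := x0 - 3 with ha
  set f : ℝ → ℝ := fun y => max (U y 0) 0 * max 0 (min 1 (3 / 2 - |y - (a + 1 / 2)|)) with hf
  have hfc : Continuous f := by
    apply Continuous.mul
    · exact hU0.max continuous_const
    · fun_prop
  have hchi0 : ∀ y, 0 ≤ max 0 (min 1 (3 / 2 - |y - (a + 1 / 2)|)) := fun y => le_max_left _ _
  have hchi1 : ∀ y, max 0 (min 1 (3 / 2 - |y - (a + 1 / 2)|)) ≤ 1 := fun y =>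
    max_le zero_le_one (min_le_left _ _)
  have hf0 : ∀ y, 0 ≤ f y := fun y => mul_nonneg (le_max_right _ _) (hchi0 y)
  have hfmax : ∀ y, f y ≤ max (U y 0) 0 := fun y =>
    mul_le_of_le_one_right (le_max_right _ _) (hchi1 y)
  have h0T : (0:ℝ) ∈ Icc 0 T := ⟨le_rfl, hT.le⟩
  have hfC : ∀ y, f y ≤ C := fun y =>
    (hfmax y).trans (max_le ((le_abs_self _).trans (hUbdd y 0 h0T)) hC)
  have hsupp : ∀ y, y ∉ Ioc (a - 1) (a + 2) → f y = 0 := by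
    intro y hy
    have : 3 / 2 ≤ |y - (a + 1 / 2)| := by
      by_cases h : a - 1 < y
      · have h2 : a + 2 < y := by
          by_contra h3; exact hy ⟨h, by linarith⟩
        exact le_trans (by linarith) (le_abs_self _)
      · push Not at h
        exact le_trans (by linarith) (neg_le_abs _)
    have h2 : max 0 (min 1 (3 / 2 - |y - (a + 1 / 2)|)) = 0 :=
      max_eq_left ((min_le_right _ _).trans (by linarith))
    simp only [hf]
    rw [h2, mul_zero]
  obtain ⟨p, px, pxx, pt, hpc, hp0, hpnn, hpC, hpx, hpxx, hpt, hpeq, hprep⟩ :=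
    aux_heat k (a - 1) (a + 2) C hk (by linarith) f hfc hf0 hfC hsupp
  set l : ℝ := -x0 / (2 * k * t0) with hl
  have hx0neg : x0 ≤ -10 := by linarith
  have hl0 : 0 ≤ l := div_nonneg (by linarith) (by positivity)
  set n : ℝ → ℝ → ℝ := fun x t => C * Real.exp (l * x + (B + k * l ^ 2) * t) with hn
  have hnn : ∀ x t, 0 ≤ n x t := fun x t => by positivity
  have hnx : ∀ x t, HasDerivAt (fun y => n y t) (l * n x t) x := by
    intro x t
    have := (((hasDerivAt_id x).const_mul l).add_const ((B + k * l ^ 2) * t)).exp.const_mul C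
    refine HasDerivAt.congr_deriv this ?_
    simp only [hn, id]
    ring
  have hnt : ∀ x t, HasDerivAt (fun s => n x s) ((B + k * l ^ 2) * n x t) t := by
    intro x t
    have := (((hasDerivAt_id t).const_mul (B + k * l ^ 2)).const_add (l * x)).exp.const_mul C
    refine HasDerivAt.congr_deriv this ?_
    simp only [hn, id]
    ring
  have het : ∀ t, HasDerivAt (fun s : ℝ => Real.exp (-B * s)) (Real.exp (-B * t) * (-B)) t := by
    intro t
    simpa using ((hasDerivAt_id t).const_mul (-B)).exp
  have hcmp := aux_maxp k B t0 (2 * C) hk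
    (fun x t => U x t - Real.exp (-B * t) * (κ * p x t) + n x t)
    (fun x t => Ux x t - Real.exp (-B * t) * (κ * px x t) + l * n x t)
    (fun x t => Uxx x t - Real.exp (-B * t) * (κ * pxx x t) + l * (l * n x t))
    (fun x t => Ut x t - (Real.exp (-B * t) * (-B) * (κ * p x t)
      + Real.exp (-B * t) * (κ * pt x t)) + (B + k * l ^ 2) * n x t)
    ?_ ?_ hB ?_ ?_ ?_ ?_ ?_ x0 t0 ⟨ht0p.le, le_rfl⟩
  · -- conclusion
    set q : ℝ := 4 * k * t0 with hq
    have hq0 : 0 < q := by positivity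
    have hexp : n x0 t0 = C * (Real.exp (B * t0) * Real.exp (-(x0 ^ 2) / q)) := by
      simp only [hn]
      rw [← Real.exp_add]
      congr 2
      rw [hl, hq]
      field_simp
      ring
    have hplow : c * ((√q)⁻¹ * Real.exp (-9 / q)) ≤ p x0 t0 := by
      rw [hprep x0 t0 ht0p]
      have hgc : Continuous fun y => f y * auxg k (x0 - y) t0 := by
        apply hfc.mul
        rw [← continuousOn_univ]
        exact (auxg_cont k hk).comp (f := fun y => (x0 - y, t0)) (by fun_prop)
          (fun y _ => ⟨mem_univ _, ht0p⟩)
      have hgnn : ∀ y, 0 ≤ f y * auxg k (x0 - y) t0 := by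
        intro y
        apply mul_nonneg (hf0 y)
        unfold auxg
        positivity
      have h1 : ∫ y in a..(a + 1), f y * auxg k (x0 - y) t0
          ≤ ∫ y in (a - 1)..(a + 2), f y * auxg k (x0 - y) t0 :=
        intervalIntegral.integral_mono_interval (by linarith) (by linarith) (by linarith)
          (Filter.Eventually.of_forall hgnn) (hgc.intervalIntegrable _ _)
      refine le_trans ?_ h1
      have h2 : ∫ y in a..(a + 1), U y 0 * ((√q)⁻¹ * Real.exp (-9 / q))
          ≤ ∫ y in a..(a + 1), f y * auxg k (x0 - y) t0 := by
        apply intervalIntegral.integral_mono_on (by linarith)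
          ((hU0.mul continuous_const).intervalIntegrable _ _) (hgc.intervalIntegrable _ _)
        intro y hy
        have hfy : f y = max (U y 0) 0 := by
          have h3 : |y - (a + 1 / 2)| ≤ 1 / 2 := by
            rw [abs_le]; constructor <;> linarith [hy.1, hy.2]
          have h4 : max 0 (min 1 (3 / 2 - |y - (a + 1 / 2)|)) = 1 := by
            rw [min_eq_left (by linarith), max_eq_right zero_le_one]
          simp only [hf]
          rw [h4, mul_one]
        rw [hfy]
        have h5 : (√q)⁻¹ * Real.exp (-9 / q) ≤ auxg k (x0 - y) t0 := by
          unfold auxg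
          rw [← hq]
          have : (x0 - y) ^ 2 ≤ 9 := by nlinarith [hy.1, hy.2]
          gcongr
        apply mul_le_mul (le_max_left _ _) h5 (by positivity) (le_max_right _ _)
      refine le_trans ?_ h2
      rw [intervalIntegral.integral_mul_const]
      apply mul_le_mul_of_nonneg_right (hmass a (by linarith)) (by positivity)
    have hlow : A * Real.exp (-9 / q) ≤ Real.exp (-B * t0) * (κ * p x0 t0) := by
      have e1 : Real.exp (-B * T) ≤ Real.exp (-B * t0) := by
        apply Real.exp_le_exp.2
        nlinarith [ht0.2]
      have hsq : 0 < √q := Real.sqrt_pos.2 hq0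
      have e2 : (√(4 * k * T))⁻¹ ≤ (√q)⁻¹ := by
        apply inv_anti₀ hsq
        apply Real.sqrt_le_sqrt
        rw [hq]
        have := ht0.2
        gcongr
      calc A * Real.exp (-9 / q)
          = Real.exp (-B * T) * (κ * (c * ((√(4 * k * T))⁻¹ * Real.exp (-9 / q)))) := by
            rw [hA]; ring
        _ ≤ Real.exp (-B * t0) * (κ * (c * ((√q)⁻¹ * Real.exp (-9 / q)))) := by gcongr
        _ ≤ _ := by gcongr
    have hnup : n x0 t0 ≤ D * Real.exp (-(x0 ^ 2) / q) := by
      rw [hexp, hD, ← mul_assoc]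
      have := ht0.2
      gcongr
    have hstrict : D * Real.exp (-(x0 ^ 2) / q) < A * Real.exp (-9 / q) := by
      set s := (x0 ^ 2 - 9) / q with hs
      have hs1 : D / A ≤ s := by
        rw [hs, le_div_iff₀ hq0]
        have h1 : D / A * q ≤ 4 * k * T * (D / A) := by
          have : q ≤ 4 * k * T := by rw [hq]; have := ht0.2; gcongr
          have h2 : 0 ≤ D / A := by positivity
          nlinarith
        nlinarith
      have hs2 : D / A < Real.exp s := by linarith [Real.add_one_le_exp s]
      have hs3 : D < A * Real.exp s := by
        rw [div_lt_iff₀ hA0] at hs2; linarith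
      have hs4 : Real.exp (-9 / q) = Real.exp s * Real.exp (-(x0 ^ 2) / q) := by
        rw [← Real.exp_add]; congr 1; rw [hs]; field_simp; ring
      rw [hs4, ← mul_assoc]
      exact mul_lt_mul_of_pos_right hs3 (Real.exp_pos _)
    linarith
  · apply Continuous.add
    · apply hUcont.sub
      apply Continuous.mul (by fun_prop)
      exact continuous_const.mul hpc
    · fun_prop
  · intro x t ht
    have h1 := (abs_le.1 (hUbdd x t ⟨ht.1, ht.2.trans ht0.2⟩)).1
    have h2 : κ * p x t ≤ C := by
      calc κ * p x t ≤ κ * (√Real.pi * C) := by have := hpC x t; gcongr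
        _ = C := by rw [hκ]; field_simp
    have h3 : Real.exp (-B * t) ≤ 1 := by
      rw [Real.exp_le_one_iff]; nlinarith [ht.1]
    have h4 : 0 ≤ κ * p x t := mul_nonneg hκ0.le (hpnn x t)
    have h5 : Real.exp (-B * t) * (κ * p x t) ≤ κ * p x t := mul_le_of_le_one_left h4 h3
    have := hnn x t
    linarith
  · intro x
    have e1 : κ * p x 0 = f x := by rw [hp0, hκ]; field_simp
    simp only [e1, mul_zero, Real.exp_zero, one_mul, hn, add_zero]
    by_cases hx : x < 0
    · have h1 := hfmax x
      rw [max_eq_left (hpos x hx)] at h1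
      have : 0 ≤ C * Real.exp (l * x) := by positivity
      linarith
    · push Not at hx
      have h1 : f x = 0 := hsupp x (fun h => by linarith [h.2])
      have h2 := (abs_le.1 (hUbdd x 0 h0T)).1
      have h3 : 1 ≤ Real.exp (l * x) := Real.one_le_exp (by positivity)
      rw [h1]
      nlinarith
  · intro x t ht
    exact ((hUx x t ⟨ht.1, ht.2.trans ht0.2⟩).sub
      (((hpx x t ht.1).const_mul κ).const_mul (Real.exp (-B * t)))).add (hnx x t)
  · intro x t ht
    exact ((hUxx x t ⟨ht.1, ht.2.trans ht0.2⟩).sub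
      (((hpxx x t ht.1).const_mul κ).const_mul (Real.exp (-B * t)))).add ((hnx x t).const_mul l)
  · intro x t ht
    exact ((hUt x t ⟨ht.1, ht.2.trans ht0.2⟩).sub
      ((het t).mul ((hpt x t ht.1).const_mul κ))).add (hnt x t)
  · intro x t ht hz
    have htT : t ∈ Ioc 0 T := ⟨ht.1, ht.2.trans ht0.2⟩
    rw [hPDE x t htT, hpeq x t ht.1]
    set P := Real.exp (-B * t) * (κ * p x t) with hP
    have hP0 : 0 ≤ P := mul_nonneg (Real.exp_pos _).le (mul_nonneg hκ0.le (hpnn x t))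
    have hN0 := hnn x t
    have hb := (abs_le.1 (hβ t htT)).1
    have h1 : -B * |U x t| ≤ β t * |U x t| := mul_le_mul_of_nonneg_right hb (abs_nonneg _)
    have h2 : |U x t| ≤ -(U x t - P + n x t) + P + n x t := by
      rw [abs_le]; constructor <;> linarith
    have h3 := mul_le_mul_of_nonneg_left h2 hB
    have e : Real.exp (-B * t) * -B * (κ * p x t) = -B * P := by rw [hP]; ring
    rw [e]
    clear_value P n
    linarith

/-- For the transformed price formation equation `U_t = k U_{xx} + β(t)|U|`
with initial datum having the buyer/vendor sign structure and uniform one-sided mass at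
infinity, the zero level set (free boundary) of `U(·,t)` is nonempty for each `t ∈ (0,T]`
and stays bounded: it cannot become unbounded in finite time. -/
theorem free_boundary_exists_and_locally_bounded
    (k T : ℝ) (hk : 0 < k) (hT : 0 < T)
    (β : ℝ → ℝ) (hβmeas : Measurable β)
    (hβbdd : ∃ Cβ, ∀ s ∈ Ioc (0 : ℝ) T, |β s| ≤ Cβ)
    (U Ux Uxx Ut : ℝ → ℝ → ℝ)
    (hUcont : Continuous fun p : ℝ × ℝ => U p.1 p.2)
    (hUbdd : ∃ C, ∀ x : ℝ, ∀ t ∈ Icc (0 : ℝ) T, |U x t| ≤ C)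
    (hUx : ∀ x : ℝ, ∀ t ∈ Ioc (0 : ℝ) T, HasDerivAt (fun y => U y t) (Ux x t) x)
    (hUxx : ∀ x : ℝ, ∀ t ∈ Ioc (0 : ℝ) T, HasDerivAt (fun y => Ux y t) (Uxx x t) x)
    (hUt : ∀ x : ℝ, ∀ t ∈ Ioc (0 : ℝ) T, HasDerivAt (fun s => U x s) (Ut x t) t)
    (hUxxcont : ContinuousOn (fun p : ℝ × ℝ => Uxx p.1 p.2) (univ ×ˢ Ioc (0 : ℝ) T))
    (hUtcont : ContinuousOn (fun p : ℝ × ℝ => Ut p.1 p.2) (univ ×ˢ Ioc (0 : ℝ) T))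
    (hPDE : ∀ x : ℝ, ∀ t ∈ Ioc (0 : ℝ) T, Ut x t = k * Uxx x t + β t * |U x t|)
    (FI : ℝ → ℝ) (hFImeas : Measurable FI) (hFIbdd : ∃ C, ∀ x, |FI x| ≤ C)
    (hInit : ∀ x : ℝ, U x 0 = FI x)
    (hFIpos : ∀ᵐ x : ℝ, x < 0 → 0 ≤ FI x)
    (hFIneg : ∀ᵐ x : ℝ, 0 < x → FI x ≤ 0)
    (c R : ℝ) (hc : 0 < c) (hR : 0 < R)
    (hmassL : ∀ x : ℝ, x ≤ -R → c ≤ ∫ ξ in Ioc x (x + 1), FI ξ)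
    (hmassR : ∀ x : ℝ, R ≤ x → (∫ ξ in Ioc x (x + 1), FI ξ) ≤ -c) :
    (∀ t ∈ Ioc (0 : ℝ) T, ∃ x : ℝ, U x t = 0) ∧
    ∃ M > 0, ∀ t ∈ Ioc (0 : ℝ) T, ∀ x : ℝ, U x t = 0 → |x| ≤ M := by
  obtain ⟨B0, hB0⟩ := hβbdd
  obtain ⟨C0, hC0⟩ := hUbdd
  have hB : ∀ s ∈ Ioc (0 : ℝ) T, |β s| ≤ |B0| := fun s hs => (hB0 s hs).trans (le_abs_self _)
  have hC : ∀ x : ℝ, ∀ t ∈ Icc (0 : ℝ) T, |U x t| ≤ |C0| :=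
    fun x t ht => (hC0 x t ht).trans (le_abs_self _)
  have hU0 : Continuous fun y => U y 0 :=
    hUcont.comp (f := fun y : ℝ => (y, (0:ℝ))) (by fun_prop)
  have hFI : (fun y => U y 0) = FI := funext hInit
  have hFc : Continuous FI := hFI ▸ hU0
  have hpos : ∀ x < 0, 0 ≤ FI x := by
    intro x hx
    by_contra h
    push Not at h
    have hopen : IsOpen (Iio 0 ∩ FI ⁻¹' Iio 0) := isOpen_Iio.inter (isOpen_Iio.preimage hFc)
    have hp := hopen.measure_pos volume ⟨x, hx, h⟩
    have hz : volume (Iio 0 ∩ FI ⁻¹' Iio 0) = 0 := by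
      refine measure_mono_null ?_ hFIpos
      rintro y ⟨hy1, hy2⟩ hy
      exact absurd (hy hy1) (not_le.2 hy2)
    exact hp.ne' hz
  have hneg : ∀ x, 0 < x → FI x ≤ 0 := by
    intro x hx
    by_contra h
    push Not at h
    have hopen : IsOpen (Ioi 0 ∩ FI ⁻¹' Ioi 0) := isOpen_Ioi.inter (isOpen_Ioi.preimage hFc)
    have hp := hopen.measure_pos volume ⟨x, hx, h⟩
    have hz : volume (Ioi 0 ∩ FI ⁻¹' Ioi 0) = 0 := by
      refine measure_mono_null ?_ hFIneg
      rintro y ⟨hy1, hy2⟩ hy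
      exact absurd (hy hy1) (not_le.2 hy2)
    exact hp.ne' hz
  obtain ⟨M1, hM1, hL⟩ := aux_left k T hk hT β |B0| |C0| (abs_nonneg _) (abs_nonneg _) hB
    U Ux Uxx Ut hUcont hC hUx hUxx hUt hPDE (fun x hx => by rw [hInit]; exact hpos x hx) c R hc hR
    (fun x hx => by
      rw [hFI, intervalIntegral.integral_of_le (by linarith)]
      exact hmassL x hx)
  obtain ⟨M2, hM2, hRt⟩ := aux_left k T hk hT (fun t => -β t) |B0| |C0| (abs_nonneg _)
    (abs_nonneg _) (fun s hs => by rw [abs_neg]; exact hB s hs)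
    (fun x t => -U (-x) t) (fun x t => Ux (-x) t) (fun x t => -Uxx (-x) t) (fun x t => -Ut (-x) t)
    (hUcont.comp (f := fun q : ℝ × ℝ => (-q.1, q.2)) (by fun_prop)).neg
    (fun x t ht => by rw [abs_neg]; exact hC _ t ht)
    (fun x t ht => by
      have := ((hUx (-x) t ht).scomp x (hasDerivAt_neg x)).neg
      refine HasDerivAt.congr_deriv this ?_
      simp)
    (fun x t ht => by
      have := ((hUxx (-x) t ht).scomp x (hasDerivAt_neg x))
      refine HasDerivAt.congr_deriv this ?_
      simp)
    (fun x t ht => (hUt (-x) t ht).neg)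
    (fun x t ht => by
      rw [hPDE (-x) t ht, abs_neg]; ring)
    (fun x hx => by
      rw [hInit]
      linarith [hneg (-x) (by linarith)])
    c (R + 1) hc (by linarith)
    (fun x hx => by
      have h1 := intervalIntegral.integral_comp_neg (a := x) (b := x + 1) (fun y => U y 0)
      rw [intervalIntegral.integral_neg, h1, hFI, intervalIntegral.integral_of_le (by linarith)]
      have h2 := hmassR (-(x + 1)) (by linarith)
      have e : -(x + 1) + 1 = -x := by ring
      rw [e] at h2
      linarith)
  have hRt' : ∀ t ∈ Ioc (0 : ℝ) T, ∀ x, M2 ≤ x → U x t < 0 := by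
    intro t ht x hx
    have := hRt t ht (-x) (by linarith)
    simp only [neg_neg] at this
    linarith
  constructor
  · intro t ht
    have hc1 : Continuous fun y => U y t :=
      hUcont.comp (f := fun y : ℝ => (y, t)) (by fun_prop)
    have hivt := intermediate_value_Icc' (show -M1 ≤ M2 by linarith) hc1.continuousOn
    obtain ⟨x, -, hx⟩ := hivt (show (0:ℝ) ∈ Icc (U M2 t) (U (-M1) t) from
      ⟨(hRt' t ht M2 le_rfl).le, (hL t ht (-M1) le_rfl).le⟩)
    exact ⟨x, hx⟩
  · refine ⟨M1 + M2, by positivity, ?_⟩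
    intro t ht x hx
    rw [abs_le]
    constructor
    · by_contra h
      push Not at h
      linarith [hL t ht x (by linarith)]
    · by_contra h
      push Not at h
      linarith [hRt' t ht x (by linarith)]
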